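/- Let n = 2k with k odd, s odd with gcd(k,s) = 1, let α and β be primitive elements of L = GF(2^n), let γ_1, …, γ_{k−1} ∈ GF(2^k), and let f(x) = α x^{2^s+1} + α^{2^k} x^{2^{k+s}+2^k} + β x^{2^k+1} + Σ_{i=1}^{k−1} γ_i x^{2^{k+i}+2^i}. Then for every a ∈ L and every b ∈ L*, f^W(a,b) ∈ {0, ±2^{n/2}, ±2^{(n+2)/2}}. -/

import Mathlib

/-- A finite set closed under addition, in a group where no three elements of the set have all
their nonempty subset sums nonzero, has at most four elements. -/
theorem card_le_four_of_no_three_independent {G : Type*} [AddCommGroup G]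
    (h2 : ∀ x : G, x + x = 0) (V : Finset G)
    (h : ∀ u ∈ V, ∀ v ∈ V, ∀ w ∈ V, u ≠ 0 → v ≠ 0 → w ≠ 0 → u + v ≠ 0 → u + w ≠ 0 → v + w ≠ 0 →
      u + v + w ≠ 0 → False) : V.card ≤ 4 := by
  classical
  by_contra! hc
  have hneg : ∀ x y : G, x + y = 0 → y = x := fun x y hxy => by
    rw [← neg_eq_of_add_eq_zero_right hxy, neg_eq_of_add_eq_zero_right (h2 x)]
  obtain ⟨u, hu, hu'⟩ := Finset.exists_mem_notMem_of_card_lt_card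
    (s := {0}) (t := V) (by rw [Finset.card_singleton]; omega)
  obtain ⟨v, hv, hv'⟩ := Finset.exists_mem_notMem_of_card_lt_card
    (s := {0, u}) (t := V) (by have := Finset.card_le_two (a := (0 : G)) (b := u); omega)
  obtain ⟨w, hw, hw'⟩ := Finset.exists_mem_notMem_of_card_lt_card
    (s := {0, u, v, u + v}) (t := V)
    (by have := Finset.card_le_four (a := (0 : G)) (b := u) (c := v) (d := u + v); omega)
  simp only [Finset.mem_singleton, Finset.mem_insert, not_or] at hu' hv' hw'
  exact h u hu v hv w hw hu' hv'.1 hw'.1 (fun e => hv'.2 (hneg _ _ e))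
    (fun e => hw'.2.1 (hneg _ _ e)) (fun e => hw'.2.2.1 (hneg _ _ e))
    (fun e => hw'.2.2.2 (hneg _ _ e))

theorem neg_one_pow_val_add (a b : ZMod 2) :
    (-1 : ℤ) ^ (a + b).val = (-1) ^ a.val * (-1) ^ b.val := by
  revert a b; decide

/-- The square of the sign sum of a quadratic form over `GF(2)` is supported on the radical of
its polar form. -/
theorem sq_sign_sum_eq_card_mul {G : Type*} [AddCommGroup G] [Fintype G] (Q : G → ZMod 2)
    (V : Finset G) (hV : ∀ u, u ∈ V ↔ ∀ x, Q (x + u) + Q x + Q u = 0)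
    (hQ : ∀ x y u, Q (x + y + u) + Q (x + y) + Q u
      = (Q (x + u) + Q x + Q u) + (Q (y + u) + Q y + Q u)) :
    (∑ x, (-1 : ℤ) ^ (Q x).val) ^ 2 = Fintype.card G * ∑ u ∈ V, (-1 : ℤ) ^ (Q u).val := by
  classical
  have step : ∀ x u, (-1 : ℤ) ^ (Q x).val * (-1) ^ (Q (x + u)).val
      = (-1) ^ (Q u).val * (-1) ^ (Q (x + u) + Q x + Q u).val := fun x u => by
    rw [← neg_one_pow_val_add, ← neg_one_pow_val_add]
    congr 2
    generalize Q (x + u) = p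
    generalize Q x = q
    generalize Q u = r
    revert p q r; decide
  have inner : ∀ u, ∑ x, (-1 : ℤ) ^ (Q (x + u) + Q x + Q u).val
      = if u ∈ V then (Fintype.card G : ℤ) else 0 := fun u => by
    split_ifs with hu
    · rw [Finset.sum_congr rfl fun x _ => by rw [(hV u).1 hu x]]
      simp
    · rw [hV] at hu
      push Not at hu
      obtain ⟨x₀, hx₀⟩ := hu
      have e := Equiv.sum_comp (Equiv.addRight x₀)
        fun x => (-1 : ℤ) ^ (Q (x + u) + Q x + Q u).val
      have hs : (-1 : ℤ) ^ (Q (x₀ + u) + Q x₀ + Q u).val = -1 := by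
        revert hx₀
        generalize Q (x₀ + u) + Q x₀ + Q u = t
        revert t; decide
      simp only [Equiv.coe_addRight, hQ, neg_one_pow_val_add (Q _ + Q _ + Q _), hs,
        ← Finset.sum_mul] at e
      linarith
  calc (∑ x, (-1 : ℤ) ^ (Q x).val) ^ 2
      = ∑ x, ∑ y, (-1 : ℤ) ^ (Q x).val * (-1) ^ (Q y).val := by
        rw [sq, Finset.sum_mul_sum]
    _ = ∑ x, ∑ u, (-1 : ℤ) ^ (Q x).val * (-1) ^ (Q (x + u)).val :=
        Finset.sum_congr rfl fun x _ => (Equiv.sum_comp (Equiv.addLeft x)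
          fun y => (-1 : ℤ) ^ (Q x).val * (-1) ^ (Q y).val).symm
    _ = ∑ u, (-1 : ℤ) ^ (Q u).val * ∑ x, (-1 : ℤ) ^ (Q (x + u) + Q x + Q u).val := by
        rw [Finset.sum_comm]
        simp only [step, Finset.mul_sum]
    _ = Fintype.card G * ∑ u ∈ V, (-1 : ℤ) ^ (Q u).val := by
        simp only [inner, mul_ite, mul_zero]
        rw [← Finset.sum_filter, Finset.mul_sum]
        simp [mul_comm]

/-- The sign sum of a quadratic form over `GF(2)` in `2 * k` variables whose polar form has a
radical of at most four elements. -/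
theorem sign_sum_of_card_radical_le_four {G : Type*} [AddCommGroup G] [Fintype G] (k : ℕ)
    (hcard : Fintype.card G = 2 ^ (2 * k)) (Q : G → ZMod 2)
    (V : Finset G) (hV : ∀ u, u ∈ V ↔ ∀ x, Q (x + u) + Q x + Q u = 0)
    (hQ : ∀ x y u, Q (x + y + u) + Q (x + y) + Q u
      = (Q (x + u) + Q x + Q u) + (Q (y + u) + Q y + Q u))
    (hV4 : V.card ≤ 4) (W : ℤ) (hW : W = ∑ x, (-1 : ℤ) ^ (Q x).val) :
    W = 0 ∨ W = 2 ^ k ∨ W = -2 ^ k ∨ W = 2 ^ (k + 1) ∨ W = -2 ^ (k + 1) := by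
  have hsq := sq_sign_sum_eq_card_mul Q V hV hQ
  rw [← hW, hcard] at hsq
  have hS : ∑ u ∈ V, (-1 : ℤ) ^ (Q u).val ≤ 4 := by
    calc ∑ u ∈ V, (-1 : ℤ) ^ (Q u).val ≤ ∑ _u ∈ V, (1 : ℤ) := by
          refine Finset.sum_le_sum fun u _ => ?_
          generalize Q u = t
          revert t; decide
      _ ≤ 4 := by simpa using hV4
  have hpow : ((2 ^ (2 * k) : ℕ) : ℤ) = (2 ^ k) ^ 2 := by push_cast; ring
  rw [hpow] at hsq
  obtain ⟨t, rfl⟩ : (2 : ℤ) ^ k ∣ W :=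
    (Int.pow_dvd_pow_iff two_ne_zero).1 ⟨_, hsq⟩
  rw [mul_pow] at hsq
  have ht := mul_left_cancel₀ (by positivity : ((2 : ℤ) ^ k) ^ 2 ≠ 0) hsq
  have h1 : t ≤ 2 := by nlinarith
  have h2 : -2 ≤ t := by nlinarith
  interval_cases t
  · right; right; right; right; ring
  · right; right; left; ring
  · left; ring
  · right; left; ring
  · right; right; right; left; ring

theorem card_pred_le_of_pow_eq_one {L : Type*} [Field L] [Fintype L] {α : L}
    (hα : ∀ y : L, y ≠ 0 → ∃ j : ℕ, y = α ^ j) {m : ℕ} (hm : 0 < m) (h : α ^ m = 1) :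
    Fintype.card L - 1 ≤ m := by
  classical
  have hsub : Finset.univ.erase (0 : L) ⊆ (Finset.range m).image (α ^ ·) := fun y hy => by
    obtain ⟨j, rfl⟩ := hα y (Finset.ne_of_mem_erase hy)
    exact Finset.mem_image.2 ⟨j % m, Finset.mem_range.2 (Nat.mod_lt _ hm),
      (pow_eq_pow_mod j h).symm⟩
  have := (Finset.card_le_card hsub).trans Finset.card_image_le
  simpa [Finset.card_erase_of_mem] using this

theorem ne_zero_of_forall_eq_pow {L : Type*} [Field L] [Fintype L] {α : L}
    (hα : ∀ y : L, y ≠ 0 → ∃ j : ℕ, y = α ^ j) (hL : 2 < Fintype.card L) : α ≠ 0 := by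
  classical
  rintro rfl
  obtain ⟨y, -, hy⟩ := Finset.exists_mem_notMem_of_card_lt_card (s := {0, 1})
    (t := (Finset.univ : Finset L))
    (lt_of_le_of_lt (Finset.card_le_two (a := (0 : L)) (b := 1)) hL)
  simp only [Finset.mem_insert, Finset.mem_singleton, not_or] at hy
  obtain ⟨j, hj⟩ := hα y hy.1
  rcases j with _ | j
  · exact hy.2 (by simpa using hj)
  · exact hy.1 (by simpa using hj)

section Trace

variable {L : Type*} [Field L] [Fintype L] [Algebra (ZMod 2) L]

theorem trace_pow_two_pow (n : ℕ) (x : L) :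
    Algebra.trace (ZMod 2) L (x ^ 2 ^ n) = Algebra.trace (ZMod 2) L x := by
  induction n with
  | zero => simp
  | succ n ih =>
    rw [pow_succ, pow_mul, ← ih]
    have := Algebra.trace_eq_of_algEquiv
      (FiniteField.frobeniusAlgEquivOfAlgebraic (ZMod 2) L) (x ^ 2 ^ n)
    simpa [FiniteField.coe_frobeniusAlgEquivOfAlgebraic] using this

theorem eq_zero_of_forall_trace_mul_eq_zero {z : L}
    (h : ∀ y, Algebra.trace (ZMod 2) L (z * y) = 0) : z = 0 :=
  (traceForm_nondegenerate (ZMod 2) L).1 z h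

/-- If `z` is trace-orthogonal to all `y ^ 2 ^ s + y`, then `z` is fixed by the `s`-th power of
the Frobenius. -/
theorem pow_two_pow_eq_self_of_trace_mul [CharP L 2] {s : ℕ} {z : L}
    (h : ∀ y, Algebra.trace (ZMod 2) L (z * (y ^ 2 ^ s + y)) = 0) : z ^ 2 ^ s = z := by
  have key : z + z ^ 2 ^ s = 0 := by
    refine eq_zero_of_forall_trace_mul_eq_zero fun y => ?_
    obtain ⟨x, rfl⟩ := (Finite.injective_iff_surjective.1 (iterateFrobenius_inj L 2 s)) y
    have h1 := h x
    have h2 := trace_pow_two_pow s (z * x)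
    rw [mul_add, map_add, ← h2] at h1
    rw [iterateFrobenius_def, add_mul, map_add, ← mul_pow]
    exact h1
  exact (CharTwo.add_eq_zero.1 key).symm

end Trace

theorem eq_zero_or_one_of_pow_two_pow {L : Type*} [Field L] [CharP L 2] {k s : ℕ}
    (hgcd : Nat.gcd k s = 1) {z : L} (hk : z ^ 2 ^ k = z) (hs : z ^ 2 ^ s = z) :
    z = 0 ∨ z = 1 := by
  have hp : ∀ n, z ^ 2 ^ n = z → Function.IsPeriodicPt (frobenius L 2) n z := fun n hn => by
    rw [Function.IsPeriodicPt, Function.IsFixedPt, iterate_frobenius, hn]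
  have h1 := (hp k hk).gcd (hp s hs)
  rw [hgcd, Function.IsPeriodicPt, Function.IsFixedPt, Function.iterate_one, frobenius_def] at h1
  have : z * (z - 1) = 0 := by linear_combination h1
  rcases mul_eq_zero.1 this with h | h
  · exact Or.inl h
  · exact Or.inr (sub_eq_zero.1 h)

/-- A primitive element of `GF(2^(2k))`, `k` odd, times a cube never lies in `GF(2^k)`. -/
theorem not_fixed_of_primitive_mul_cube {L : Type*} [Field L] [Fintype L] {k s : ℕ}
    (hkodd : Odd k) (hsodd : Odd s) (hcard : Fintype.card L = 2 ^ (2 * k)) {α : L}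
    (hα : ∀ y : L, y ≠ 0 → ∃ j : ℕ, y = α ^ j) {u : L} (hu : u ≠ 0) :
    (α * u ^ (2 ^ s + 1)) ^ 2 ^ k ≠ α * u ^ (2 ^ s + 1) := by
  intro h
  have hdvd : ∀ n : ℕ, Odd n → 3 ∣ 2 ^ n + 1 := fun n hn => by
    simpa using hn.nat_add_dvd_pow_add_pow 2 1
  obtain ⟨p, hp⟩ := hdvd k hkodd
  obtain ⟨t, ht⟩ := hdvd s hsodd
  obtain ⟨k', rfl⟩ := hkodd
  have hq : 2 ≤ 2 ^ (2 * k' + 1) := by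
    rw [pow_succ]
    have := Nat.one_le_two_pow (n := 2 * k')
    omega
  obtain ⟨r, hr⟩ : ∃ r, 2 ^ (2 * k' + 1) = r + 1 := ⟨2 ^ (2 * k' + 1) - 1, by omega⟩
  have hr1 : 1 ≤ r := by omega
  have hp1 : 1 ≤ p := Nat.pos_of_ne_zero fun hp0 => by
    rw [hp0, mul_zero] at hp
    exact Nat.succ_ne_zero _ hp
  have hcard' : Fintype.card L = r * (3 * p) + 1 := by
    rw [hcard, ← hp, pow_mul', hr]; ring
  have hα0 : α ≠ 0 := ne_zero_of_forall_eq_pow hα (by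
    rw [hcard']
    nlinarith)
  have hw0 : α * u ^ (2 ^ s + 1) ≠ 0 := mul_ne_zero hα0 (pow_ne_zero _ hu)
  have hw1 : (α * u ^ (2 ^ s + 1)) ^ r = 1 := by
    rw [hr, pow_succ] at h
    exact mul_right_cancel₀ hw0 (by rw [h, one_mul])
  have hu1 : u ^ (r * (3 * p)) = 1 := by
    have := FiniteField.pow_card_sub_one_eq_one u hu
    rwa [hcard', Nat.add_sub_cancel] at this
  have hα1 : α ^ (r * p) = 1 := by
    have e : (α * u ^ (2 ^ s + 1)) ^ (r * p) = 1 := by rw [pow_mul, hw1, one_pow]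
    rw [mul_pow, ht, ← pow_mul, show 3 * t * (r * p) = r * (3 * p) * t by ring,
      pow_mul u, hu1, one_pow, mul_one] at e
    exact e
  have hrp : 0 < r * p := Nat.mul_pos hr1 hp1
  have := card_pred_le_of_pow_eq_one hα hrp hα1
  rw [hcard', Nat.add_sub_cancel] at this
  nlinarith

theorem not_fixed_of_primitive {L : Type*} [Field L] [Fintype L] {k : ℕ}
    (hk : 0 < k) (hcard : Fintype.card L = 2 ^ (2 * k)) {β : L}
    (hβ : ∀ y : L, y ≠ 0 → ∃ j : ℕ, y = β ^ j) : β ^ 2 ^ k ≠ β := by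
  intro h
  have hq : 2 ≤ 2 ^ k := by simpa using Nat.pow_le_pow_right (n := 2) (by omega) hk
  obtain ⟨r, hr⟩ : ∃ r, 2 ^ k = r + 1 := ⟨2 ^ k - 1, by omega⟩
  have hcard' : Fintype.card L = r * (r + 2) + 1 := by
    rw [hcard, pow_mul', hr]; ring
  have hr1 : 1 ≤ r := by omega
  have hβ0 : β ≠ 0 := ne_zero_of_forall_eq_pow hβ (by rw [hcard']; nlinarith)
  have h1 : β ^ r = 1 := by
    rw [hr, pow_succ] at h
    exact mul_right_cancel₀ hβ0 (by rw [h, one_mul])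
  have := card_pred_le_of_pow_eq_one hβ hr1 h1
  rw [hcard', Nat.add_sub_cancel] at this
  nlinarith

/-- Let `n = 2k` with `k` odd, `s` odd with `gcd(k,s) = 1`, let `α, β` be primitive
elements of `L = GF(2^n)`, let `γ_1, …, γ_{k-1} ∈ GF(2^k)` (the subfield of `L`
with `2^k` elements, i.e. the fixed field of `x ↦ x^{2^k}`), and let
`f(x) = α x^{2^s+1} + α^{2^k} x^{2^{k+s}+2^k} + β x^{2^k+1} + ∑_{i=1}^{k-1} γ_i x^{2^{k+i}+2^i}`.
Then for every `a ∈ L` and `b ∈ L^*`,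
`f^W(a,b) ∈ {0, ±2^{n/2}, ±2^{(n+2)/2}} = {0, ±2^k, ±2^{k+1}}`. -/
theorem stmt4 (k s : ℕ) (hkodd : Odd k) (hsodd : Odd s) (hgcd : Nat.gcd k s = 1)
    (L : Type*) [Field L] [Fintype L] [Algebra (ZMod 2) L]
    (hcard : Fintype.card L = 2 ^ (2 * k))
    (α : L) (hα : ∀ y : L, y ≠ 0 → ∃ j : ℕ, y = α ^ j)
    (β : L) (hβ : ∀ y : L, y ≠ 0 → ∃ j : ℕ, y = β ^ j)
    (γ : ℕ → L) (hγ : ∀ i ∈ Finset.Icc 1 (k - 1), γ i ^ (2 ^ k) = γ i)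
    (f : L → L)
    (hf : ∀ x, f x = α * x ^ (2 ^ s + 1) + α ^ (2 ^ k) * x ^ (2 ^ (k + s) + 2 ^ k)
        + β * x ^ (2 ^ k + 1)
        + ∑ i ∈ Finset.Icc 1 (k - 1), γ i * x ^ (2 ^ (k + i) + 2 ^ i))
    (a b : L) (hb : b ≠ 0)
    (W : ℤ)
    (hW : W = ∑ x : L, (-1 : ℤ) ^ (Algebra.trace (ZMod 2) L (a * x + b * f x)).val) :
    W = 0 ∨ W = 2 ^ k ∨ W = -2 ^ k ∨ W = 2 ^ (k + 1) ∨ W = -2 ^ (k + 1) := by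
  classical
  have : CharP L 2 := charP_of_injective_algebraMap (algebraMap (ZMod 2) L).injective 2
  set tr := Algebra.trace (ZMod 2) L with htr
  have hfrob : ∀ (n : ℕ) (x y : L), (x + y) ^ 2 ^ n = x ^ 2 ^ n + y ^ 2 ^ n :=
    fun n x y => add_pow_char_pow x y 2 n
  have hinv : ∀ x : L, (x ^ 2 ^ k) ^ 2 ^ k = x := fun x => by
    rw [← pow_mul, ← pow_add, ← two_mul, ← hcard, FiniteField.pow_card]
  have h2 : (2 : L) = 0 := CharTwo.two_eq_zero
  have hk : 0 < k := hkodd.pos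
  let P : L → L → L := fun x y => x ^ 2 ^ s * y + x * y ^ 2 ^ s
  let R : L → L → L := fun x y => x ^ 2 ^ k * y + x * y ^ 2 ^ k
  let D : L → L → L := fun x y => α * P x y + (α * P x y) ^ 2 ^ k + β * R x y
    + ∑ i ∈ Finset.Icc 1 (k - 1), γ i * R x y ^ 2 ^ i
  have hP : ∀ x y u, P (x + y) u = P x u + P y u := fun x y u => by
    simp only [P, hfrob]; ring
  have hR : ∀ x y u, R (x + y) u = R x u + R y u := fun x y u => by
    simp only [R, hfrob]; ring
  have hD : ∀ x y u, D (x + y) u = D x u + D y u := fun x y u => by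
    simp only [D, hP, hR, hfrob, mul_add, Finset.sum_add_distrib]; ring
  have hf' : ∀ x, f x = α * x ^ (2 ^ s + 1) + (α * x ^ (2 ^ s + 1)) ^ 2 ^ k
      + β * x ^ (2 ^ k + 1) + ∑ i ∈ Finset.Icc 1 (k - 1), γ i * (x ^ (2 ^ k + 1)) ^ 2 ^ i :=
    fun x => by
      rw [hf x]
      simp only [mul_pow, ← pow_mul, add_mul, one_mul, ← pow_add, add_comm s k]
  have hN : ∀ (n : ℕ) (x y : L), (x + y) ^ (2 ^ n + 1)
      = x ^ (2 ^ n + 1) + y ^ (2 ^ n + 1) + (x ^ 2 ^ n * y + x * y ^ 2 ^ n) := fun n x y => by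
    simp only [pow_succ _ (2 ^ n), hfrob]; ring
  have hpolar : ∀ x u, f (x + u) + f x + f u = D x u := fun x u => by
    simp only [hf', hN, D, P, R, hfrob, mul_add, Finset.sum_add_distrib]
    generalize (∑ i ∈ Finset.Icc 1 (k - 1), γ i * (x ^ (2 ^ k + 1)) ^ 2 ^ i) = S₁
    generalize (∑ i ∈ Finset.Icc 1 (k - 1), γ i * (u ^ (2 ^ k + 1)) ^ 2 ^ i) = S₂
    linear_combination (α * x ^ (2 ^ s + 1) + (α * x ^ (2 ^ s + 1)) ^ 2 ^ k
      + β * x ^ (2 ^ k + 1) + S₁ + (α * u ^ (2 ^ s + 1) + (α * u ^ (2 ^ s + 1)) ^ 2 ^ k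
      + β * u ^ (2 ^ k + 1) + S₂)) * h2
  have hB : ∀ x u, tr (a * (x + u) + b * f (x + u)) + tr (a * x + b * f x) + tr (a * u + b * f u)
      = tr (b * D x u) := fun x u => by
    rw [← map_add, ← map_add, ← hpolar]
    congr 1
    linear_combination (a * x + a * u) * h2
  refine sign_sum_of_card_radical_le_four k hcard (fun x => tr (a * x + b * f x))
    (Finset.univ.filter fun u => ∀ x, tr (b * D x u) = 0) (fun u => by simp only [hB, Finset.mem_filter, Finset.mem_univ, true_and])
    (fun x y u => by rw [hB, hB, hB, hD, mul_add, map_add]) ?_ W hW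
  by_cases hc : b + b ^ 2 ^ k = 0
  · have hbfix : b ^ 2 ^ k = b := (CharTwo.add_eq_zero.1 hc).symm
    have hT : β + β ^ 2 ^ k ≠ 0 := fun e =>
      not_fixed_of_primitive hk hcard hβ (CharTwo.add_eq_zero.1 e).symm
    have hTfix : (β + β ^ 2 ^ k) ^ 2 ^ k = β + β ^ 2 ^ k := by
      rw [hfrob, hinv, add_comm]
    have htrK : ∀ κ : L, κ ^ 2 ^ k = κ → tr κ = 0 := fun κ hκ => by
      have e : κ = κ * β / (β + β ^ 2 ^ k) + (κ * β / (β + β ^ 2 ^ k)) ^ 2 ^ k := by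
        rw [div_pow, mul_pow, hκ, hTfix, ← add_div, ← mul_add, mul_div_cancel_right₀ _ hT]
      rw [e, map_add, htr, trace_pow_two_pow]
      exact CharTwo.add_self_eq_zero _
    have hRfix : ∀ x u, R x u ^ 2 ^ k = R x u := fun x u => by
      simp only [R, hfrob, mul_pow, hinv]; ring
    have hker : ∀ u, (∀ x, tr (b * D x u) = 0) → u = 0 := fun u hu => by
      have hz : b * (β + β ^ 2 ^ k) * u ^ 2 ^ k = 0 := by
        refine eq_zero_of_forall_trace_mul_eq_zero fun x => ?_
        have h0 : tr (b * (D x u + β * R x u)) = 0 := by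
          refine htrK _ ?_
          have e : D x u + β * R x u = α * P x u + (α * P x u) ^ 2 ^ k
              + ∑ i ∈ Finset.Icc 1 (k - 1), γ i * R x u ^ 2 ^ i := by
            simp only [D]
            linear_combination β * R x u * h2
          rw [e, mul_pow, hbfix, hfrob, hfrob, hinv, sum_pow_char_pow 2 k]
          congr 2
          · ring
          · refine Finset.sum_congr rfl fun i hi => ?_
            rw [mul_pow, hγ i hi, pow_right_comm, hRfix]
        rw [mul_add, map_add, hu x, zero_add] at h0
        have h1 : tr (b * β * (x ^ 2 ^ k * u)) = tr (b * β ^ 2 ^ k * (x * u ^ 2 ^ k)) := by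
          rw [htr, ← trace_pow_two_pow k (b * β * (x ^ 2 ^ k * u))]
          simp only [mul_pow, hbfix, hinv]
        rw [show b * (β * R x u) = b * β * (x ^ 2 ^ k * u) + b * β * (x * u ^ 2 ^ k) by
          simp only [R]; ring, map_add, h1, ← map_add] at h0
        rw [← h0]
        congr 1
        ring
      by_contra hu0
      exact mul_ne_zero (mul_ne_zero hb hT) (pow_ne_zero _ hu0) hz
    refine (Finset.card_le_one.2 fun u hu v hv => ?_).trans (by norm_num)
    rw [Finset.mem_filter] at hu hv
    rw [hker u hu.2, hker v hv.2]
  · let g : L → L := fun u => α * u ^ (2 ^ s + 1) + (α * u ^ (2 ^ s + 1)) ^ 2 ^ k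
    have hgfix : ∀ u, g u ^ 2 ^ k = g u := fun u => by
      simp only [g, hfrob, hinv]; ring
    have hcfix : (b + b ^ 2 ^ k) ^ 2 ^ k = b + b ^ 2 ^ k := by
      rw [hfrob, hinv, add_comm]
    have hone : ∀ u, (∀ x, tr (b * D x u) = 0) → u ≠ 0 → (b + b ^ 2 ^ k) * g u = 1 := by
      intro u hu hu0
      have hDg : ∀ t : L, t ^ 2 ^ k = t → D (t * u) u = (t ^ 2 ^ s + t) * g u := fun t ht => by
        have hR0 : R (t * u) u = 0 := by
          simp only [R, mul_pow, ht]
          linear_combination (t * u ^ 2 ^ k * u) * h2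
        have hPt : P (t * u) u = (t ^ 2 ^ s + t) * u ^ (2 ^ s + 1) := by
          simp only [P, mul_pow]; ring
        have ht' : (t ^ 2 ^ s + t) ^ 2 ^ k = t ^ 2 ^ s + t := by
          rw [hfrob, pow_right_comm, ht]
        simp only [D, hR0, hPt, g, mul_pow, ht']
        simp
        ring
      have hs' : ((b + b ^ 2 ^ k) * g u) ^ 2 ^ s = (b + b ^ 2 ^ k) * g u := by
        refine pow_two_pow_eq_self_of_trace_mul fun y => ?_
        have ht : (y + y ^ 2 ^ k) ^ 2 ^ k = y + y ^ 2 ^ k := by rw [hfrob, hinv, add_comm]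
        have h0 := hu ((y + y ^ 2 ^ k) * u)
        rw [hDg _ ht, hfrob] at h0
        have h1 : tr (b * g u * (y ^ 2 ^ s + y) ^ 2 ^ k)
            = tr (b ^ 2 ^ k * g u * (y ^ 2 ^ s + y)) := by
          rw [htr, ← trace_pow_two_pow k (b * g u * (y ^ 2 ^ s + y) ^ 2 ^ k)]
          simp only [mul_pow, hgfix, hinv]
        rw [show b * ((y ^ 2 ^ s + (y ^ 2 ^ k) ^ 2 ^ s + (y + y ^ 2 ^ k)) * g u)
            = b * g u * (y ^ 2 ^ s + y) + b * g u * (y ^ 2 ^ s + y) ^ 2 ^ k by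
          rw [hfrob, pow_right_comm y (2 ^ s)]; ring, map_add, h1, ← map_add] at h0
        rw [← htr, ← h0]
        congr 1
        ring
      refine (eq_zero_or_one_of_pow_two_pow hgcd (by rw [mul_pow, hcfix, hgfix]) hs').resolve_left
        fun e => ?_
      have hg0 : g u = 0 := (mul_eq_zero.1 e).resolve_left hc
      exact not_fixed_of_primitive_mul_cube hkodd hsodd hcard hα hu0
        (CharTwo.add_eq_zero.1 hg0).symm
    have hDsymm : ∀ x u, D x u = D u x := fun x u => by
      rw [← hpolar, ← hpolar, add_comm x u]; ring
    have hadd : ∀ u v, (∀ x, tr (b * D x u) = 0) → (∀ x, tr (b * D x v) = 0) →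
        ∀ x, tr (b * D x (u + v)) = 0 := fun u v hu hv x => by
      rw [hDsymm, hD, hDsymm u, hDsymm v, mul_add, map_add, hu, hv, add_zero]
    refine card_le_four_of_no_three_independent CharTwo.add_self_eq_zero _ ?_
    intro u hu v hv w hw hu0 hv0 hw0 huv huw hvw huvw
    simp only [Finset.mem_filter, Finset.mem_univ, true_and] at hu hv hw
    have e1 := hone u hu hu0
    have e2 := hone v hv hv0
    have e3 := hone w hw hw0
    have e4 := hone _ (hadd u v hu hv) huv
    have e5 := hone _ (hadd u w hu hw) huw
    have e6 := hone _ (hadd v w hv hw) hvw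
    have e7 := hone _ (hadd _ w (hadd u v hu hv) hw) huvw
    have hsum : g (u + v + w) = g (u + v) + g (u + w) + g (v + w) + g u + g v + g w := by
      have hpol : ∀ x y, g (x + y) = g x + g y + (α * P x y + (α * P x y) ^ 2 ^ k) :=
        fun x y => by simp only [g, hN, P, mul_add, hfrob]; ring
      rw [hpol (u + v), hpol u w, hpol v w, hP]
      simp only [mul_add, hfrob]
      linear_combination -(g u + g v + g w) * h2
    rw [hsum] at e7
    exact one_ne_zero (α := L) (by linear_combination e1 + e2 + e3 + e4 + e5 + e6 - e7 + 3 * h2)
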